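/- Let Λ be a symbol with odd defect, rank(Λ) = n and Υ(Λ) = [λ; μ]. Then there exists a symbol Λ' of rank n' with (Λ, Λ') ∈ B^−_{n,n'} if and only if n' ≥ n − μ_1 + (def(Λ) + 1)/2. Moreover, if n' = n − μ_1 + (def(Λ) + 1)/2 and (Λ, Λ') ∈ B^−_{n,n'}, then Υ(Λ')^* = μ², Υ(Λ')_* = λ and def(Λ') = −def(Λ) − 1; in particular Λ' is unique up to equivalence of symbols. -/

import Mathlib

namespace GGP

/-- A *symbol* `Λ = (A; B)`: an ordered pair of finite sets of natural numbers. -/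
structure Symbol where
  A : Finset ℕ
  B : Finset ℕ

namespace Symbol

/-- The rank of a symbol:
`rank(Λ) = Σ_{a∈A} a + Σ_{b∈B} b − ⌊((|A|+|B|−1)/2)²⌋ = Σ + Σ − ⌊(|A|+|B|−1)²/4⌋`. -/
def rank (Λ : Symbol) : ℤ :=
  (∑ a ∈ Λ.A, (a : ℤ)) + (∑ b ∈ Λ.B, (b : ℤ))
    - ((Λ.A.card : ℤ) + (Λ.B.card : ℤ) - 1) ^ 2 / 4

/-- The defect of a symbol: `def(Λ) = |A| − |B| ∈ ℤ`. -/
def defect (Λ : Symbol) : ℤ := (Λ.A.card : ℤ) - (Λ.B.card : ℤ)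

/-- The shift of a symbol: `(a_1,…,a_m; b_1,…,b_l) ↦ (a_1+1,…,a_m+1,0; b_1+1,…,b_l+1,0)`. -/
def shift (Λ : Symbol) : Symbol :=
  ⟨insert 0 (Λ.A.image (· + 1)), insert 0 (Λ.B.image (· + 1))⟩

/-- Equivalence of symbols: one is obtained from the other by finitely many shifts. -/
def Equiv (Λ M : Symbol) : Prop :=
  ∃ k l : ℕ, shift^[k] Λ = shift^[l] M

end Symbol

/-- The partition associated to a finite set `A = {a_1 > … > a_m}` of naturals:
the function sending the index `i` (0-based, so `i` stands for the (i+1)-st part)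
to `λ_{i+1} = a_{i+1} − (m − (i+1))`, with parts beyond the length equal to `0`. -/
def upsFun (A : Finset ℕ) : ℕ → ℕ := fun i =>
  if h : i < A.card then
    (A.sort (· ≤ ·))[A.card - 1 - i]'(by rw [Finset.length_sort]; omega)
      - (A.card - 1 - i)
  else 0

/-- `|λ|`: the sum of the parts of a partition (given as a function). -/
noncomputable def psize (f : ℕ → ℕ) : ℕ := ∑ᶠ i, f i

/-- The transpose of a partition: `(ᵗλ)_{i+1} = #{ j : λ_{j+1} ≥ i+1 }` (0-based index `i`). -/
noncomputable def transposeFun (f : ℕ → ℕ) : ℕ → ℕ := fun i => Set.ncard {j | i + 1 ≤ f j}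

/-- `λ ≼ μ` : `μ_i − 1 ≤ λ_i ≤ μ_i` for every `i`. -/
def Prec (f g : ℕ → ℕ) : Prop := ∀ i, g i - 1 ≤ f i ∧ f i ≤ g i

/-- `λ²`: the partition obtained from `λ` by deleting one copy of its largest part. -/
def tailPart (f : ℕ → ℕ) : ℕ → ℕ := fun i => f (i + 1)

/-- A function `ℕ → ℕ` represents a partition iff it is antitone and eventually zero. -/
def IsPartitionFun (f : ℕ → ℕ) : Prop :=
  Antitone f ∧ ∃ N, ∀ i, N ≤ i → f i = 0

/-- `(Λ, Λ') ∈ B^+_{n,n'}`. -/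
def BPlus (n n' : ℕ) (Λ Λ' : Symbol) : Prop :=
  Λ.rank = (n : ℤ) ∧ Λ'.rank = (n' : ℤ) ∧
    Prec (transposeFun (upsFun Λ'.B)) (transposeFun (upsFun Λ.A)) ∧
    Prec (transposeFun (upsFun Λ.B)) (transposeFun (upsFun Λ'.A)) ∧
    Λ'.defect = -Λ.defect + 1

/-- `(Λ, Λ') ∈ B^−_{n,n'}`. -/
def BMinus (n n' : ℕ) (Λ Λ' : Symbol) : Prop :=
  Λ.rank = (n : ℤ) ∧ Λ'.rank = (n' : ℤ) ∧
    Prec (transposeFun (upsFun Λ'.A)) (transposeFun (upsFun Λ.B)) ∧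
    Prec (transposeFun (upsFun Λ.A)) (transposeFun (upsFun Λ'.B)) ∧
    Λ'.defect = -Λ.defect - 1

/-- A symbol is reduced if not both rows contain `0`. -/
def Reduced (Λ : Symbol) : Prop := ¬ (0 ∈ Λ.A ∧ 0 ∈ Λ.B)


/-- The set of `m` naturals whose decreasing enumeration is `f i + (m - 1 - i)`. -/
def ofPart (f : ℕ → ℕ) (m : ℕ) : Finset ℕ :=
  (Finset.range m).image fun j => f (m - 1 - j) + j

lemma upsFun_of_le {A : Finset ℕ} {i : ℕ} (h : A.card ≤ i) : upsFun A i = 0 := by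
  simp [upsFun, Nat.not_lt.mpr h]

lemma upsFun_of_lt {A : Finset ℕ} {i : ℕ} (h : i < A.card) :
    upsFun A i = A.orderEmbOfFin rfl ⟨A.card - 1 - i, by omega⟩ - (A.card - 1 - i) := by
  simp [upsFun, h, Finset.orderEmbOfFin_apply]

lemma add_le_of_strictMono {m : ℕ} {g : Fin m → ℕ} (hg : StrictMono g) (i : Fin m) (k : ℕ)
    (hk : i.1 + k < m) : g i + k ≤ g ⟨i.1 + k, hk⟩ := by
  induction k with
  | zero => rfl
  | succ k ih =>
    have h : g ⟨i.1 + k, by omega⟩ < g ⟨i.1 + (k + 1), hk⟩ := hg (Fin.mk_lt_mk.mpr (by omega))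
    have := ih (by omega)
    omega

lemma le_orderEmbOfFin (A : Finset ℕ) (i : Fin A.card) : i.1 ≤ A.orderEmbOfFin rfl i := by
  have h := add_le_of_strictMono (A.orderEmbOfFin rfl).strictMono ⟨0, i.pos⟩ i.1
    (by simp)
  simp only [zero_add, Fin.eta] at h
  omega

lemma upsFun_antitone (A : Finset ℕ) : Antitone (upsFun A) := by
  refine antitone_nat_of_succ_le fun i => ?_
  by_cases h : i + 1 < A.card
  · rw [upsFun_of_lt h, upsFun_of_lt (by omega : i < A.card)]
    have : A.orderEmbOfFin rfl ⟨A.card - 1 - (i + 1), by omega⟩ <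
        A.orderEmbOfFin rfl ⟨A.card - 1 - i, by omega⟩ :=
      (A.orderEmbOfFin rfl).strictMono (Fin.mk_lt_mk.mpr (by omega))
    omega
  · rw [upsFun_of_le (by omega)]
    exact Nat.zero_le _

lemma ofPart_upsFun (A : Finset ℕ) : ofPart (upsFun A) A.card = A := by
  conv_rhs => rw [← Finset.image_orderEmbOfFin_univ A rfl]
  have key : ∀ j : Fin A.card, upsFun A (A.card - 1 - j) + j = A.orderEmbOfFin rfl j := by
    intro j
    have hj := j.2
    have e : A.card - 1 - (A.card - 1 - j.1) = j.1 := by omega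
    rw [upsFun_of_lt (by omega)]
    simp only [e, Fin.eta]
    exact Nat.sub_add_cancel (le_orderEmbOfFin A j)
  ext a
  simp only [ofPart, Finset.mem_image, Finset.mem_range, Finset.mem_univ, true_and]
  exact ⟨fun ⟨j, hj, h⟩ => ⟨⟨j, hj⟩, by rw [← h, ← key ⟨j, hj⟩]⟩,
    fun ⟨j, h⟩ => ⟨j, j.2, by rw [← h, key j]⟩⟩

lemma strictMono_reflect_add_id {f : ℕ → ℕ} (hf : Antitone f) (m : ℕ) :
    StrictMono fun j => f (m - 1 - j) + j := fun i j hij => by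
  have : f (m - 1 - i) ≤ f (m - 1 - j) := hf (by omega)
  dsimp only
  omega

lemma card_ofPart {f : ℕ → ℕ} (hf : Antitone f) (m : ℕ) : (ofPart f m).card = m := by
  rw [ofPart, Finset.card_image_of_injective _ (strictMono_reflect_add_id hf m).injective,
    Finset.card_range]

lemma upsFun_ofPart {f : ℕ → ℕ} (hf : Antitone f) {m : ℕ} (hm : ∀ i, m ≤ i → f i = 0) :
    upsFun (ofPart f m) = f := by
  have hc := card_ofPart hf m
  funext i
  by_cases h : i < (ofPart f m).card
  · rw [upsFun_of_lt h, ← Finset.orderEmbOfFin_unique (s := ofPart f m) rfl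
      (f := fun j => f (m - 1 - j) + j)
      (fun j => Finset.mem_image_of_mem _ (Finset.mem_range.mpr (j.2.trans_eq hc)))
      (fun a b hab => strictMono_reflect_add_id hf m hab)]
    have e : m - 1 - (m - 1 - i) = i := by omega
    simp only [hc, e]
    omega
  · rw [upsFun_of_le (by omega), hm i (by omega)]

lemma insert_zero_image_ofPart {f : ℕ → ℕ} {m : ℕ} (hm : f m = 0) :
    insert 0 ((ofPart f m).image (· + 1)) = ofPart f (m + 1) := by
  ext a
  simp only [ofPart, Finset.mem_insert, Finset.mem_image, Finset.mem_range,
    exists_exists_and_eq_and]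
  constructor
  · rintro (rfl | ⟨j, hj, rfl⟩)
    · exact ⟨0, by omega, by simp [hm]⟩
    · refine ⟨j + 1, by omega, ?_⟩
      rw [show m + 1 - 1 - (j + 1) = m - 1 - j by omega]
      omega
  · rintro ⟨_ | j, hj, rfl⟩
    · left
      simp [hm]
    · refine Or.inr ⟨j, by omega, ?_⟩
      rw [show m + 1 - 1 - (j + 1) = m - 1 - j by omega]
      omega

lemma shift_iterate_ofPart {f g : ℕ → ℕ} {p q : ℕ} (hf : ∀ i, p ≤ i → f i = 0)
    (hg : ∀ i, q ≤ i → g i = 0) (k : ℕ) :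
    Symbol.shift^[k] ⟨ofPart f p, ofPart g q⟩ = ⟨ofPart f (p + k), ofPart g (q + k)⟩ := by
  induction k with
  | zero => rfl
  | succ k ih =>
    rw [Function.iterate_succ_apply', ih, Symbol.shift,
      insert_zero_image_ofPart (hf _ (by omega)), insert_zero_image_ofPart (hg _ (by omega))]
    rfl

lemma Symbol.equiv_of_upsFun_eq {Λ M : Symbol} (hA : upsFun Λ.A = upsFun M.A)
    (hB : upsFun Λ.B = upsFun M.B) (hd : Λ.defect = M.defect) : Symbol.Equiv Λ M := by
  refine ⟨M.A.card, Λ.A.card, ?_⟩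
  have h (X : Symbol) (k : ℕ) : Symbol.shift^[k] X =
      ⟨ofPart (upsFun X.A) (X.A.card + k), ofPart (upsFun X.B) (X.B.card + k)⟩ := by
    rw [← shift_iterate_ofPart (fun _ => upsFun_of_le) (fun _ => upsFun_of_le),
      ofPart_upsFun, ofPart_upsFun]
  have e : Λ.B.card + M.A.card = M.B.card + Λ.A.card := by
    unfold Symbol.defect at hd
    omega
  rw [h, h, hA, hB, e, add_comm Λ.A.card]

lemma sum_range_upsFun (A : Finset ℕ) {N : ℕ} (hN : A.card ≤ N) :
    ∑ i ∈ Finset.range N, upsFun A i = ∑ i ∈ Finset.range A.card, upsFun A i :=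
  (Finset.sum_subset (Finset.range_subset_range.mpr hN) fun i _ hi =>
    upsFun_of_le (by simpa using hi)).symm

lemma two_mul_sum_eq (A : Finset ℕ) {N : ℕ} (hN : A.card ≤ N) :
    2 * ∑ a ∈ A, (a : ℤ) =
      2 * ((∑ i ∈ Finset.range N, upsFun A i : ℕ) : ℤ) + (A.card : ℤ) ^ 2 - A.card := by
  have h1 : ∑ a ∈ A, a =
      ∑ i ∈ Finset.range A.card, upsFun A i + ∑ i ∈ Finset.range A.card, i := by
    conv_lhs => rw [← ofPart_upsFun A, ofPart,
      Finset.sum_image (strictMono_reflect_add_id (upsFun_antitone A) _).injective.injOn,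
      Finset.sum_add_distrib, Finset.sum_range_reflect (upsFun A)]
  have h2 : (2 : ℤ) * (∑ i ∈ Finset.range A.card, i : ℕ) = (A.card : ℤ) ^ 2 - A.card := by
    have h3 := Finset.sum_range_id_mul_two A.card
    rcases Nat.eq_zero_or_pos A.card with h | h
    · simp [h]
    · zify [h] at h3 ⊢
      linarith
  rw [sum_range_upsFun A hN, ← Nat.cast_sum, h1]
  push_cast at h2 ⊢
  linarith

lemma four_mul_rank_of_odd {Λ : Symbol} (h : Odd Λ.defect) {N : ℕ} (hA : Λ.A.card ≤ N)
    (hB : Λ.B.card ≤ N) :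
    4 * Λ.rank = 4 * ((∑ i ∈ Finset.range N, upsFun Λ.A i : ℕ) : ℤ) +
      4 * ((∑ i ∈ Finset.range N, upsFun Λ.B i : ℕ) : ℤ) + Λ.defect ^ 2 - 1 := by
  have h1 := two_mul_sum_eq Λ.A hA
  have h2 := two_mul_sum_eq Λ.B hB
  obtain ⟨t, ht⟩ := h
  unfold Symbol.defect at *
  unfold Symbol.rank
  have e : ((Λ.A.card : ℤ) + Λ.B.card - 1) ^ 2 = 4 * (Λ.B.card + t) ^ 2 := by
    rw [show (Λ.A.card : ℤ) = Λ.B.card + 2 * t + 1 by omega]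
    ring
  have e' : ((Λ.A.card : ℤ) + Λ.B.card - 1) ^ 2 / 4 = (Λ.B.card + t) ^ 2 := by omega
  rw [e']
  linear_combination 2 * h1 + 2 * h2 + e

lemma four_mul_rank_of_even {Λ : Symbol} (h : Even Λ.defect) {N : ℕ} (hA : Λ.A.card ≤ N)
    (hB : Λ.B.card ≤ N) :
    4 * Λ.rank = 4 * ((∑ i ∈ Finset.range N, upsFun Λ.A i : ℕ) : ℤ) +
      4 * ((∑ i ∈ Finset.range N, upsFun Λ.B i : ℕ) : ℤ) + Λ.defect ^ 2 := by
  have h1 := two_mul_sum_eq Λ.A hA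
  have h2 := two_mul_sum_eq Λ.B hB
  obtain ⟨t, ht⟩ := h
  unfold Symbol.defect at *
  unfold Symbol.rank
  have e : ((Λ.A.card : ℤ) + Λ.B.card - 1) ^ 2 =
      4 * ((Λ.B.card + t) * (Λ.B.card + t - 1)) + 1 := by
    rw [show (Λ.A.card : ℤ) = Λ.B.card + t + t by omega]
    ring
  have e' : ((Λ.A.card : ℤ) + Λ.B.card - 1) ^ 2 / 4 =
      (Λ.B.card + t) * (Λ.B.card + t - 1) := by omega
  rw [e']
  linear_combination 2 * h1 + 2 * h2 + e

lemma lt_transposeFun_iff {f : ℕ → ℕ} (hf : IsPartitionFun f) (i j : ℕ) :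
    j < transposeFun f i ↔ i < f j := by
  obtain ⟨hanti, N, hN⟩ := hf
  have hfin : {j | i + 1 ≤ f j}.Finite := by
    refine (Set.finite_Iio N).subset fun k hk => ?_
    by_contra h
    have := hN k (by simpa using h)
    simp only [Set.mem_ofPred_eq] at hk
    omega
  unfold transposeFun
  constructor
  · intro h
    by_contra h'
    have hsub : {j | i + 1 ≤ f j} ⊆ Finset.range j := fun k hk => by
      by_contra hkj
      have : f k ≤ f j := hanti (by simpa using hkj)
      simp only [Set.mem_ofPred_eq] at hk
      omega
    have := Set.ncard_le_ncard hsub (Finset.finite_toSet _)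
    rw [Set.ncard_coe_finset, Finset.card_range] at this
    omega
  · intro h
    have hsub : (Finset.range (j + 1) : Set ℕ) ⊆ {j | i + 1 ≤ f j} := fun k hk => by
      have : f j ≤ f k := hanti (Nat.lt_succ_iff.mp (by simpa using hk))
      simp only [Set.mem_ofPred_eq]
      omega
    have := Set.ncard_le_ncard hsub hfin
    rw [Set.ncard_coe_finset, Finset.card_range] at this
    omega

lemma prec_transposeFun_iff {f g : ℕ → ℕ} (hf : IsPartitionFun f) (hg : IsPartitionFun g) :
    Prec (transposeFun f) (transposeFun g) ↔ ∀ j, g (j + 1) ≤ f j ∧ f j ≤ g j := by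
  constructor
  · intro h j
    constructor
    · by_contra! hlt
      have h1 := (lt_transposeFun_iff hg (f j) (j + 1)).2 hlt
      have h2 := (lt_transposeFun_iff hf (f j) j).not.2 (lt_irrefl _)
      have := (h (f j)).1
      omega
    · by_contra! hlt
      have h1 := (lt_transposeFun_iff hf (g j) j).2 hlt
      have h2 := (lt_transposeFun_iff hg (g j) j).not.2 (lt_irrefl _)
      have := (h (g j)).2
      omega
  · intro h i
    constructor
    · by_contra! hlt
      have h1 := (lt_transposeFun_iff hg i (transposeFun f i + 1)).1 (by omega)
      have h2 := (lt_transposeFun_iff hf i (transposeFun f i)).not.1 (lt_irrefl _)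
      have := (h (transposeFun f i)).1
      omega
    · by_contra! hlt
      have h1 := (lt_transposeFun_iff hf i (transposeFun g i)).1 hlt
      have h2 := (lt_transposeFun_iff hg i (transposeFun g i)).not.1 (lt_irrefl _)
      have := (h (transposeFun g i)).2
      omega

lemma isPartitionFun_upsFun (A : Finset ℕ) : IsPartitionFun (upsFun A) :=
  ⟨upsFun_antitone A, A.card, fun _ => upsFun_of_le⟩

lemma bMinus_iff {n n' : ℕ} {Λ Λ' : Symbol} : BMinus n n' Λ Λ' ↔
    Λ.rank = n ∧ Λ'.rank = n' ∧
      (∀ j, upsFun Λ.B (j + 1) ≤ upsFun Λ'.A j ∧ upsFun Λ'.A j ≤ upsFun Λ.B j) ∧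
      (∀ j, upsFun Λ'.B (j + 1) ≤ upsFun Λ.A j ∧ upsFun Λ.A j ≤ upsFun Λ'.B j) ∧
      Λ'.defect = -Λ.defect - 1 := by
  rw [BMinus, prec_transposeFun_iff (isPartitionFun_upsFun _) (isPartitionFun_upsFun _),
    prec_transposeFun_iff (isPartitionFun_upsFun _) (isPartitionFun_upsFun _)]

/-- Comparison of the ranks of two symbols through partition sizes, when their defects sum to `-1`
and the first defect is odd. -/
lemma rank_eq_of_defect {Λ Λ' : Symbol} (hodd : Odd Λ.defect)
    (hd : Λ'.defect = -Λ.defect - 1) {N : ℕ} (hA : Λ.A.card ≤ N) (hB : Λ.B.card ≤ N)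
    (hA' : Λ'.A.card ≤ N) (hB' : Λ'.B.card ≤ N) :
    Λ'.rank = Λ.rank - upsFun Λ.B 0 + (Λ.defect + 1) / 2 +
      (((∑ i ∈ Finset.range N, upsFun Λ'.A i : ℕ) : ℤ) -
        (∑ i ∈ Finset.range N, tailPart (upsFun Λ.B) i : ℕ)) +
      (((∑ i ∈ Finset.range N, upsFun Λ'.B i : ℕ) : ℤ) -
        (∑ i ∈ Finset.range N, upsFun Λ.A i : ℕ)) := by
  have h1 := four_mul_rank_of_odd hodd hA hB
  have h2 := four_mul_rank_of_even (by rw [hd]; exact hodd.neg.sub_odd odd_one) hA' hB'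
  have h3 : ∑ i ∈ Finset.range N, upsFun Λ.B i =
      ∑ i ∈ Finset.range N, tailPart (upsFun Λ.B) i + upsFun Λ.B 0 := by
    rw [sum_range_upsFun Λ.B hB, ← sum_range_upsFun Λ.B (hB.trans N.le_succ),
      Finset.sum_range_succ']
    rfl
  rw [hd] at h2
  rw [h3] at h1
  have h4 : (-Λ.defect - 1) ^ 2 = Λ.defect ^ 2 + 2 * Λ.defect + 1 := by ring
  obtain ⟨t, ht⟩ := hodd
  push_cast at h1 h2 ⊢
  omega

lemma exists_bMinus {Λ : Symbol} (hodd : Odd Λ.defect) {n n' : ℕ} (hn : Λ.rank = n)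
    (h : (n : ℤ) - (upsFun Λ.B 0 : ℤ) + (Λ.defect + 1) / 2 ≤ n') :
    ∃ Λ' : Symbol, BMinus n n' Λ Λ' := by
  obtain ⟨r, hr⟩ := Int.le.dest h
  set f := tailPart (upsFun Λ.B)
  set g : ℕ → ℕ := fun i => upsFun Λ.A i + if i = 0 then r else 0 with hg_def
  have hf : Antitone f := fun i j hij => upsFun_antitone Λ.B (Nat.succ_le_succ hij)
  have hg : Antitone g := fun i j hij => by
    have := upsFun_antitone Λ.A hij
    simp only [hg_def]
    split_ifs <;> omega
  set p := Λ.B.card + 1 with hp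
  set q := Λ.A.card + 2 with hq
  have hfp : ∀ i, p ≤ i → f i = 0 := fun i hi => upsFun_of_le (by omega)
  have hgq : ∀ i, q ≤ i → g i = 0 := fun i hi => by
    simp only [hg_def]
    rw [upsFun_of_le (by omega), if_neg (by omega)]
  have hfu := upsFun_ofPart hf hfp
  have hgu := upsFun_ofPart hg hgq
  have hcf := card_ofPart hf p
  have hcg := card_ofPart hg q
  have hd : (⟨ofPart f p, ofPart g q⟩ : Symbol).defect = -Λ.defect - 1 := by
    simp only [Symbol.defect, hcf, hcg]
    push_cast [hp, hq]
    ring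
  refine ⟨⟨ofPart f p, ofPart g q⟩, bMinus_iff.2 ⟨hn, ?_, fun j => ?_, fun j => ?_, hd⟩⟩
  · rw [rank_eq_of_defect (N := p + q) hodd hd (by omega) (by omega) (by simp [hcf])
      (by simp [hcg]), hn]
    simp only [hfu, hgu]
    have hs : ∑ i ∈ Finset.range (p + q), g i =
        ∑ i ∈ Finset.range (p + q), upsFun Λ.A i + r := by
      rw [hg_def, Finset.sum_add_distrib, Finset.sum_ite_eq', if_pos (by simp; omega)]
    rw [hs]
    push_cast
    linarith
  · rw [hfu]
    exact ⟨le_rfl, upsFun_antitone Λ.B j.le_succ⟩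
  · rw [hgu]
    have := upsFun_antitone Λ.A j.le_succ
    simp only [hg_def]
    exact ⟨by simpa using this, Nat.le_add_right _ _⟩

lemma le_of_bMinus {Λ Λ' : Symbol} (hodd : Odd Λ.defect) {n n' : ℕ} (h : BMinus n n' Λ Λ') :
    (n : ℤ) - (upsFun Λ.B 0 : ℤ) + (Λ.defect + 1) / 2 ≤ n' ∧
      ((n' : ℤ) = (n : ℤ) - (upsFun Λ.B 0 : ℤ) + (Λ.defect + 1) / 2 →
        upsFun Λ'.A = tailPart (upsFun Λ.B) ∧ upsFun Λ'.B = upsFun Λ.A) := by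
  obtain ⟨hn, hn', h1, h2, hd⟩ := bMinus_iff.1 h
  have hr (N : ℕ) := rank_eq_of_defect
    (N := Λ.A.card + Λ.B.card + Λ'.A.card + Λ'.B.card + N) hodd hd
    (by omega) (by omega) (by omega) (by omega)
  have hs1 (N : ℕ) := Finset.sum_le_sum (s := Finset.range N) fun i _ => (h1 i).1
  have hs2 (N : ℕ) := Finset.sum_le_sum (s := Finset.range N) fun i _ => (h2 i).2
  rw [hn, hn'] at hr
  unfold tailPart at *
  refine ⟨?_, fun he => ?_⟩
  · have := hr 0
    have := hs1 (Λ.A.card + Λ.B.card + Λ'.A.card + Λ'.B.card + 0)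
    have := hs2 (Λ.A.card + Λ.B.card + Λ'.A.card + Λ'.B.card + 0)
    omega
  · have key (i : ℕ) : upsFun Λ.B (i + 1) = upsFun Λ'.A i ∧ upsFun Λ.A i = upsFun Λ'.B i := by
      have e := hr (i + 1)
      have e1 := hs1 (Λ.A.card + Λ.B.card + Λ'.A.card + Λ'.B.card + (i + 1))
      have e2 := hs2 (Λ.A.card + Λ.B.card + Λ'.A.card + Λ'.B.card + (i + 1))
      have hi : i ∈ Finset.range (Λ.A.card + Λ.B.card + Λ'.A.card + Λ'.B.card + (i + 1)) := by
        simp only [Finset.mem_range]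
        omega
      exact ⟨(Finset.sum_eq_sum_iff_of_le fun i _ => (h1 i).1).1 (by omega) i hi,
        (Finset.sum_eq_sum_iff_of_le fun i _ => (h2 i).2).1 (by omega) i hi⟩
    exact ⟨funext fun i => (key i).1.symm, funext fun i => (key i).2.symm⟩

/-- For a symbol `Λ` of odd defect, rank `n` and `Υ(Λ) = [λ; μ]`: a symbol `Λ'` of
rank `n'` with `(Λ, Λ') ∈ B^−_{n,n'}` exists iff `n' ≥ n − μ_1 + (def(Λ)+1)/2`;
moreover, if `n' = n − μ_1 + (def(Λ)+1)/2` then any such `Λ'` has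
`Υ(Λ')^* = μ²`, `Υ(Λ')_* = λ`, `def(Λ') = −def(Λ)−1`, and is unique up to
equivalence. -/
theorem statement9 (Λ : Symbol) (hodd : Odd Λ.defect) (n : ℕ) (hn : Λ.rank = (n : ℤ)) :
    (∀ n' : ℕ, (∃ Λ' : Symbol, BMinus n n' Λ Λ') ↔
      (n : ℤ) - (upsFun Λ.B 0 : ℤ) + (Λ.defect + 1) / 2 ≤ (n' : ℤ)) ∧
    (∀ n' : ℕ, (n' : ℤ) = (n : ℤ) - (upsFun Λ.B 0 : ℤ) + (Λ.defect + 1) / 2 →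
      (∀ Λ' : Symbol, BMinus n n' Λ Λ' →
        upsFun Λ'.A = tailPart (upsFun Λ.B) ∧ upsFun Λ'.B = upsFun Λ.A ∧
        Λ'.defect = -Λ.defect - 1) ∧
      (∀ Λ' Λ'' : Symbol, BMinus n n' Λ Λ' → BMinus n n' Λ Λ'' → Symbol.Equiv Λ' Λ'')) := by
  refine ⟨fun n' => ⟨fun ⟨Λ', h⟩ => (le_of_bMinus hodd h).1, exists_bMinus hodd hn⟩,
    fun n' he => ⟨fun Λ' h => ?_, fun Λ' Λ'' h h' => ?_⟩⟩
  · obtain ⟨hA, hB⟩ := (le_of_bMinus hodd h).2 he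
    exact ⟨hA, hB, h.2.2.2.2⟩
  · obtain ⟨hA, hB⟩ := (le_of_bMinus hodd h).2 he
    obtain ⟨hA', hB'⟩ := (le_of_bMinus hodd h').2 he
    exact Symbol.equiv_of_upsFun_eq (hA.trans hA'.symm) (hB.trans hB'.symm)
      (h.2.2.2.2.trans h'.2.2.2.2.symm)

end GGP
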